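/- arXiv:1201.6075 — 6 statements merged into one kernel-verified Lean document; each statement's English description precedes it below -/
import Mathlib

section
/- Let p and q be natural numbers and suppose ℂ^(p+q) = E_u ⊕ E_0 ⊕ E_s is an internal direct sum of complex subspaces such that E_u and E_s are isotropic for the standard pseudo-Hermitian form of signature (p,q), E_0 is orthogonal to both E_u and E_s (⟨x,y⟩ = 0 for all x ∈ E_0 and y ∈ E_u ∪ E_s), and dim_ℂ E_0 = |p − q|. Then the restriction of the form to E_0 is either positive definite or negative definite; in particular E_0 contains no nonzero vector v with ⟨v,v⟩ = 0. -/
/-- The standard pseudo-Hermitian form of signature `(p,q)` on `ℂ^(p+q)`. -/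
noncomputable def pseudoHermForm (p q : ℕ) (a b : Fin (p + q) → ℂ) : ℂ :=
  ∑ i : Fin (p + q), (if (i : ℕ) < p then (1 : ℂ) else -1) * a i * (starRingEnd ℂ) (b i)

/-- Diagonal sesquilinear form with real coefficients. -/
noncomputable def diagForm {n : ℕ} (s : Fin n → ℝ) (a b : Fin n → ℂ) : ℂ :=
  ∑ i, (s i : ℂ) * a i * (starRingEnd ℂ) (b i)

lemma diagForm_self_re {n : ℕ} (s : Fin n → ℝ) (a : Fin n → ℂ) :
    (diagForm s a a).re = ∑ i, s i * Complex.normSq (a i) := by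
  unfold diagForm
  rw [Complex.re_sum]
  refine Finset.sum_congr rfl fun i _ => ?_
  rw [mul_assoc, Complex.mul_conj, ← Complex.ofReal_mul, Complex.ofReal_re]

lemma diagForm_conj {n : ℕ} (s : Fin n → ℝ) (a b : Fin n → ℂ) :
    diagForm s a b = (starRingEnd ℂ) (diagForm s b a) := by
  unfold diagForm
  rw [map_sum]
  refine Finset.sum_congr rfl fun i _ => ?_
  simp only [map_mul, Complex.conj_ofReal, Complex.conj_conj]
  ring

lemma diagForm_expand {n : ℕ} (s : Fin n → ℝ) (e v : Fin n → ℂ) (c : ℂ) :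
    diagForm s (e + c • v) (e + c • v) = diagForm s e e + c * diagForm s v e
      + (starRingEnd ℂ) c * diagForm s e v + c * (starRingEnd ℂ) c * diagForm s v v := by
  unfold diagForm
  simp only [Finset.mul_sum, ← Finset.sum_add_distrib]
  refine Finset.sum_congr rfl fun i _ => ?_
  simp only [Pi.add_apply, Pi.smul_apply, smul_eq_mul, map_add, map_mul]
  ring

/-- A nonpositive vector orthogonal to an isotropic subspace bounds the dimension. -/
lemma isotropic_dim_bound {n : ℕ} (s : Fin n → ℝ) (E : Submodule ℂ (Fin n → ℂ))
    (hE : ∀ e ∈ E, diagForm s e e = 0) (v : Fin n → ℂ) (hvE : v ∉ E)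
    (hv : ∀ e ∈ E, diagForm s v e = 0) (hneg : (diagForm s v v).re ≤ 0) :
    Module.finrank ℂ E + 1 ≤ Fintype.card {i // ¬ 0 < s i} := by
  let T : (E × ℂ) →ₗ[ℂ] ({i // ¬ 0 < s i} → ℂ) :=
    (LinearMap.funLeft ℂ ℂ (Subtype.val : {i // ¬ 0 < s i} → Fin n)) ∘ₗ
      (LinearMap.coprod E.subtype (LinearMap.toSpanSingleton ℂ (Fin n → ℂ) v))
  have hT : Function.Injective T := by
    rw [injective_iff_map_eq_zero]
    rintro ⟨⟨e, he⟩, c⟩ h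
    have hz : ∀ i, ¬ 0 < s i → (e + c • v) i = 0 := fun i hi => congrFun h ⟨i, hi⟩
    have hre : (diagForm s (e + c • v) (e + c • v)).re ≤ 0 := by
      rw [diagForm_expand, hE e he, hv e he, diagForm_conj s e v, hv e he, Complex.mul_conj]
      simp only [mul_zero, map_zero, zero_add, Complex.re_ofReal_mul]
      exact mul_nonpos_of_nonneg_of_nonpos (Complex.normSq_nonneg c) hneg
    rw [diagForm_self_re] at hre
    have hnn : ∀ i ∈ Finset.univ, 0 ≤ s i * Complex.normSq ((e + c • v) i) := by
      intro i _
      by_cases hi : 0 < s i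
      · exact mul_nonneg hi.le (Complex.normSq_nonneg _)
      · rw [hz i hi]; simp
    have h0 := (Finset.sum_eq_zero_iff_of_nonneg hnn).1
      (le_antisymm hre (Finset.sum_nonneg hnn))
    have hw : e + c • v = 0 := by
      funext i
      by_cases hi : 0 < s i
      · rcases mul_eq_zero.1 (h0 i (Finset.mem_univ i)) with h1 | h1
        · exact absurd h1 hi.ne'
        · exact Complex.normSq_eq_zero.1 h1
      · exact hz i hi
    have hc : c = 0 := by
      by_contra hc
      apply hvE
      have : c • v ∈ E := by
        rw [← neg_eq_of_add_eq_zero_right hw]; exact E.neg_mem he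
      exact (E.smul_mem_iff hc).1 this
    subst hc
    have he0 : e = 0 := by simpa using hw
    subst he0
    rfl
  have := LinearMap.finrank_le_finrank_of_injective hT
  simpa using this

/-- The signs. -/
noncomputable def pqSign (p q : ℕ) (i : Fin (p + q)) : ℝ := if (i : ℕ) < p then 1 else -1

lemma form_eq (p q : ℕ) (a b : Fin (p + q) → ℂ) :
    diagForm (pqSign p q) a b = pseudoHermForm p q a b := by
  unfold diagForm pseudoHermForm pqSign
  refine Finset.sum_congr rfl fun i _ => ?_
  split_ifs <;> simp

lemma form_neg_eq (p q : ℕ) (a b : Fin (p + q) → ℂ) :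
    diagForm (fun i => - pqSign p q i) a b = - pseudoHermForm p q a b := by
  rw [← form_eq]
  unfold diagForm
  simp [Finset.sum_neg_distrib]

lemma card_lt (p q : ℕ) : Fintype.card {i : Fin (p + q) // (i : ℕ) < p} = p := by
  rw [Fintype.card_subtype]
  simp [Fin.card_filter_val_lt]

lemma card_pos (p q : ℕ) : Fintype.card {i // ¬ 0 < pqSign p q i} = q := by
  have h : ∀ i, 0 < pqSign p q i ↔ (i : ℕ) < p := by
    intro i; unfold pqSign; split_ifs with h <;> simp [h]
  rw [Fintype.card_subtype_compl, Fintype.card_congr (Equiv.subtypeEquivRight h), card_lt]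
  simp

lemma card_neg (p q : ℕ) : Fintype.card {i // ¬ 0 < - pqSign p q i} = p := by
  have h : ∀ i, ¬ 0 < - pqSign p q i ↔ (i : ℕ) < p := by
    intro i; unfold pqSign; split_ifs with h <;> simp [h]
  rw [Fintype.card_congr (Equiv.subtypeEquivRight h), card_lt]

/-- If `ℂ^(p+q) = E_u ⊕ E_0 ⊕ E_s` with `E_u, E_s` isotropic, `E_0` orthogonal to both
`E_u` and `E_s`, and `dim E_0 = |p - q|`, then the restriction of the standard
pseudo-Hermitian form of signature `(p,q)` to `E_0` is positive definite or negative
definite; in particular `E_0` contains no nonzero isotropic vector. -/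
theorem neutral_definite_of_minimal_dim (p q : ℕ)
    (Eu E0 Es : Submodule ℂ (Fin (p + q) → ℂ))
    (hdirect : DirectSum.IsInternal (![Eu, E0, Es] : Fin 3 → Submodule ℂ (Fin (p + q) → ℂ)))
    (hu : ∀ v ∈ Eu, pseudoHermForm p q v v = 0)
    (hs : ∀ v ∈ Es, pseudoHermForm p q v v = 0)
    (horth : ∀ x ∈ E0, ∀ y : Fin (p + q) → ℂ, (y ∈ Eu ∨ y ∈ Es) →
      pseudoHermForm p q x y = 0)
    (hdim : (Module.finrank ℂ E0 : ℤ) = |(p : ℤ) - q|) :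
    ((∀ v ∈ E0, v ≠ 0 → 0 < (pseudoHermForm p q v v).re) ∨
      (∀ v ∈ E0, v ≠ 0 → (pseudoHermForm p q v v).re < 0)) ∧
    (∀ v ∈ E0, pseudoHermForm p q v v = 0 → v = 0) := by
  have hfin : Module.finrank ℂ Eu + Module.finrank ℂ E0 + Module.finrank ℂ Es = p + q := by
    have h := (LinearEquiv.ofBijective (DirectSum.coeLinearMap
      (![Eu, E0, Es] : Fin 3 → Submodule ℂ (Fin (p + q) → ℂ))) hdirect).finrank_eq
    rw [Module.finrank_directSum, Fin.sum_univ_three] at h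
    rw [Module.finrank_fin_fun] at h
    exact h
  have hind := hdirect.submodule_iSupIndep.pairwiseDisjoint
  have hdu : Disjoint E0 Eu := hind (show (1 : Fin 3) ≠ 0 by decide)
  have hds : Disjoint E0 Es := hind (show (1 : Fin 3) ≠ 2 by decide)
  have hmain : (∀ v ∈ E0, v ≠ 0 → 0 < (pseudoHermForm p q v v).re) ∨
      (∀ v ∈ E0, v ≠ 0 → (pseudoHermForm p q v v).re < 0) := by
    rcases le_total q p with hqp | hpq
    · left
      intro v hv hv0
      by_contra hcon
      have hb : ∀ E : Submodule ℂ (Fin (p + q) → ℂ), Disjoint E0 E →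
          (∀ e ∈ E, pseudoHermForm p q e e = 0) → (∀ e ∈ E, pseudoHermForm p q v e = 0) →
          Module.finrank ℂ E + 1 ≤ q := by
        intro E hd h1 h2
        have := isotropic_dim_bound (pqSign p q) E (by simpa only [form_eq] using h1) v
          (fun h => hv0 (Submodule.disjoint_def.1 hd v hv h))
          (by simpa only [form_eq] using h2) (by rw [form_eq]; exact not_lt.1 hcon)
        rwa [card_pos] at this
      have b1 := hb Eu hdu hu (fun e he => horth v hv e (Or.inl he))
      have b2 := hb Es hds hs (fun e he => horth v hv e (Or.inr he))
      rw [abs_of_nonneg (by omega)] at hdim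
      omega
    · right
      intro v hv hv0
      by_contra hcon
      have hb : ∀ E : Submodule ℂ (Fin (p + q) → ℂ), Disjoint E0 E →
          (∀ e ∈ E, pseudoHermForm p q e e = 0) → (∀ e ∈ E, pseudoHermForm p q v e = 0) →
          Module.finrank ℂ E + 1 ≤ p := by
        intro E hd h1 h2
        have := isotropic_dim_bound (fun i => - pqSign p q i) E
          (by simpa only [form_neg_eq, neg_eq_zero] using h1) v
          (fun h => hv0 (Submodule.disjoint_def.1 hd v hv h))
          (by simpa only [form_neg_eq, neg_eq_zero] using h2)
          (by rw [form_neg_eq, Complex.neg_re]; linarith [not_lt.1 hcon])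
        rwa [card_neg] at this
      have b1 := hb Eu hdu hu (fun e he => horth v hv e (Or.inl he))
      have b2 := hb Es hds hs (fun e he => horth v hv e (Or.inr he))
      rw [abs_of_nonpos (by omega)] at hdim
      omega
  refine ⟨hmain, fun v hv h => ?_⟩
  by_contra hv0
  rcases hmain with h1 | h1
  · have := h1 v hv hv0
    simp [h] at this
  · have := h1 v hv hv0
    simp [h] at this
end

section
/- Let ζ = exp(2πi/3) and let A and B be the explicit 4×4 complex matrices A = [[0,0,1,ζ²],[ζ,0,0,ζ],[0,ζ,0,ζ],[0,0,0,−ζ²]] and B = [[0,ζ²−1,ζ,0],[0,ζ,0,0],[ζ,ζ−ζ²,1−ζ²,0],[1−ζ²,1−ζ²,1−ζ,1]]. Then the characteristic polynomial of the product C = B·A equals T⁴ + (ζ²−ζ)T³ − 2ζ²T² + (ζ²−1)T + ζ, and this polynomial factors in ℂ[T] as (T−1)·(T³ − 2ζT² + 2T − ζ). -/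
open Polynomial

/-- `ζ = exp(2πi/3)`, a primitive third root of unity. -/
noncomputable def ζ : ℂ := Complex.exp (2 * Real.pi * Complex.I / 3)

/-- The monodromy matrix `A`. -/
noncomputable def matA : Matrix (Fin 4) (Fin 4) ℂ :=
  !![0, 0, 1, ζ^2;
     ζ, 0, 0, ζ;
     0, ζ, 0, ζ;
     0, 0, 0, -ζ^2]

/-- The monodromy matrix `B`. -/
noncomputable def matB : Matrix (Fin 4) (Fin 4) ℂ :=
  !![0,       ζ^2 - 1, ζ,       0;
     0,       ζ,       0,       0;
     ζ,       ζ - ζ^2, 1 - ζ^2, 0;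
     1 - ζ^2, 1 - ζ^2, 1 - ζ,   1]

theorem ζ_rel : ζ ^ 2 + ζ + 1 = 0 := by
  have h : IsPrimitiveRoot ζ 3 := by
    have := Complex.isPrimitiveRoot_exp 3 (by norm_num)
    simpa [ζ] using this
  have h3 := h.geom_sum_eq_zero (by norm_num)
  simp only [Finset.sum_range_succ, Finset.sum_range_zero] at h3
  linear_combination h3

theorem charpoly_aux : (matB * matA).charpoly =
      X ^ 4 + C (ζ^2 - ζ) * X ^ 3 - C (2 * ζ^2) * X ^ 2 + C (ζ^2 - 1) * X + C ζ := by
  have h : (C ζ : ℂ[X]) ^ 2 + C ζ + 1 = 0 := by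
    rw [← C_pow, ← C_add, ← C_1, ← C_add, ζ_rel, C_0]
  rw [Matrix.charpoly, Matrix.charmatrix, matA, matB]
  simp [Matrix.det_succ_row_zero, Fin.sum_univ_succ, Fin.succAbove, Matrix.diagonal]
  have h2 : (C 2 : ℂ[X]) = 2 := map_ofNat C 2
  rw [h2]
  generalize (C ζ : ℂ[X]) = z at *
  grind

/-- The characteristic polynomial of `C = B·A` is
`T⁴ + (ζ²−ζ)T³ − 2ζ²T² + (ζ²−1)T + ζ = (T−1)(T³ − 2ζT² + 2T − ζ)`. -/
theorem charpoly_matB_mul_matA :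
    (matB * matA).charpoly =
      X ^ 4 + C (ζ^2 - ζ) * X ^ 3 - C (2 * ζ^2) * X ^ 2 + C (ζ^2 - 1) * X + C ζ ∧
    (matB * matA).charpoly =
      (X - 1) * (X ^ 3 - C (2 * ζ) * X ^ 2 + C 2 * X - C ζ) := by
  refine ⟨charpoly_aux, ?_⟩
  have h : (C ζ : ℂ[X]) ^ 2 + C ζ + 1 = 0 := by
    rw [← C_pow, ← C_add, ← C_1, ← C_add, ζ_rel, C_0]
  rw [charpoly_aux]
  simp only [map_sub, map_mul, map_pow, map_one, map_ofNat]
  linear_combination (X ^ 3 - 2 * X ^ 2 + X) * h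
end

section
/- No complex root of the polynomial M(T) = T⁶ + 2T⁵ + 8T⁴ + 5T³ + 8T² + 2T + 1 is a root of unity: if μ ∈ ℂ satisfies M(μ) = 0, then μ^n ≠ 1 for every integer n ≥ 1. In particular, M is not a cyclotomic polynomial. -/
open Polynomial in
theorem aeval_lit (u : ℂ) : aeval u (2 : ℤ[X]) = 2 ∧ aeval u (5 : ℤ[X]) = 5 := by
  constructor
  · exact map_ofNat (aeval u) 2
  · exact map_ofNat (aeval u) 5

theorem chebyshev_C_eval_add_inv (z : ℂ) (hz : z ≠ 0) (n : ℕ) :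
    (Polynomial.Chebyshev.C ℂ n).eval (z + z⁻¹) = z ^ n + z⁻¹ ^ n := by
  rw [← Polynomial.dickson_one_one_eq_chebyshev_C,
    Polynomial.dickson_one_one_eval_add_inv z z⁻¹ (mul_inv_cancel₀ hz)]

open Polynomial in
theorem trace_cubic_dvd (u : ℂ) (hu : u ^ 3 + 2 * u ^ 2 + 5 * u + 1 = 0) (Q : ℤ[X])
    (hQ : aeval u Q = 0) : (X ^ 3 + 2 * X ^ 2 + 5 * X + 1 : ℤ[X]) ∣ Q := by
  set P : ℤ[X] := X ^ 3 + 2 * X ^ 2 + 5 * X + 1 with hP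
  have hdeg : P.natDegree = 3 := by rw [hP]; compute_degree!
  have hmon : P.Monic := by rw [hP]; monicity!
  have hPu : aeval u P = 0 := by simp [hP, hu, (aeval_lit u).1, (aeval_lit u).2]
  have hint : IsIntegral ℤ u := ⟨P, hmon, hPu⟩
  have hirr : Irreducible P := by
    rw [hmon.irreducible_iff_roots_eq_zero_of_degree_le_three (by omega) (by omega)]
    rw [Multiset.eq_zero_iff_forall_notMem]
    intro a ha
    have h := (mem_roots'.1 ha).2
    simp [hP, IsRoot] at h
    have h2 := congrArg (fun z : ℤ => (z : ZMod 2)) h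
    push_cast at h2
    generalize (a : ZMod 2) = b at h2
    revert b
    decide
  have h1 : minpoly ℤ u ∣ P := minpoly.isIntegrallyClosed_dvd hint hPu
  have h2 : minpoly ℤ u ∣ Q := minpoly.isIntegrallyClosed_dvd hint hQ
  have h3 : ¬ IsUnit (minpoly ℤ u) := minpoly.not_isUnit ℤ u
  exact ((hirr.dvd_iff.1 h1).resolve_left h3).dvd.trans h2

/-- No complex root of `M(T) = T⁶ + 2T⁵ + 8T⁴ + 5T³ + 8T² + 2T + 1` is a root of unity.
In particular, `M` is not a cyclotomic polynomial. -/
theorem no_root_of_M_is_root_of_unity (μ : ℂ)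
    (hμ : μ ^ 6 + 2 * μ ^ 5 + 8 * μ ^ 4 + 5 * μ ^ 3 + 8 * μ ^ 2 + 2 * μ + 1 = 0) :
    ∀ n : ℕ, 1 ≤ n → μ ^ n ≠ 1 := by
  intro n hn h1
  -- a sum `z + z⁻¹` with `z` a root of unity is real
  have hreal : ∀ z : ℂ, z ^ n = 1 → (z + z⁻¹).im = 0 := by
    intro z hz
    have hz1 : ‖z‖ = 1 := Complex.norm_eq_one_of_pow_eq_one hz (by omega)
    rw [Complex.inv_eq_conj hz1]
    simp
  have hμ0 : μ ≠ 0 := by rintro rfl; simp at hμ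
  have hu : (μ + μ⁻¹) ^ 3 + 2 * (μ + μ⁻¹) ^ 2 + 5 * (μ + μ⁻¹) + 1 = 0 := by
    field_simp
    linear_combination hμ
  have him := hreal μ h1
  have hC : Polynomial.aeval (μ + μ⁻¹) (Polynomial.Chebyshev.C ℤ n - 2) = 0 := by
    rw [map_sub, Polynomial.Chebyshev.aeval_C,
      chebyshev_C_eval_add_inv μ hμ0, (aeval_lit _).1]
    simp [h1]
    norm_num
  obtain ⟨R, hR⟩ := trace_cubic_dvd _ hu _ hC
  obtain ⟨x, hx⟩ : ∃ x : ℝ, μ + μ⁻¹ = x := ⟨_, (Complex.ext rfl (by simpa using him))⟩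
  rw [hx] at hu
  set s : ℝ := Real.sqrt (16 + 4 * x + 3 * x ^ 2) with hs
  have hpos : 0 < 16 + 4 * x + 3 * x ^ 2 := by nlinarith [sq_nonneg (x + 1)]
  have hs0 : 0 < s := Real.sqrt_pos.2 hpos
  have hs2 : s ^ 2 = 16 + 4 * x + 3 * x ^ 2 := Real.sq_sqrt hpos.le
  have hs2c : (s : ℂ) ^ 2 = 16 + 4 * x + 3 * x ^ 2 := by exact_mod_cast hs2
  set w : ℂ := (-(2 + x) + Complex.I * s) / 2 with hw
  have hq : w ^ 2 + (2 + x) * w + (5 + 2 * x + x ^ 2) = 0 := by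
    rw [hw]
    linear_combination (s : ℂ) ^ 2 / 4 * Complex.I_sq - hs2c / 4
  have hPw : w ^ 3 + 2 * w ^ 2 + 5 * w + 1 = 0 := by
    linear_combination (w - x) * hq + hu
  have hwim : w.im ≠ 0 := by
    have : w.im = s / 2 := by simp [hw]
    rw [this]; positivity
  obtain ⟨z, hz⟩ : ∃ z : ℂ, z ^ 2 - w * z + 1 = 0 := by
    obtain ⟨d, hd⟩ := IsAlgClosed.exists_pow_nat_eq (w ^ 2 - 4) (n := 2) (by norm_num)
    exact ⟨(w + d) / 2, by linear_combination hd / 4⟩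
  have hz0 : z ≠ 0 := by rintro rfl; simp at hz
  have hwz : w = z + z⁻¹ := by
    field_simp
    linear_combination -hz
  have hCw : Polynomial.aeval w (Polynomial.Chebyshev.C ℤ n - 2) = 0 := by
    rw [hR, map_mul]
    simp [hPw, (aeval_lit w).1, (aeval_lit w).2]
  rw [map_sub, Polynomial.Chebyshev.aeval_C, hwz,
    chebyshev_C_eval_add_inv z hz0, (aeval_lit _).1] at hCw
  simp only [inv_pow] at hCw
  have hzn : z ^ n ≠ 0 := pow_ne_zero _ hz0
  have hfin : z ^ n = 1 := by
    field_simp at hCw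
    have : (z ^ n - 1) ^ 2 = 0 := by linear_combination hCw
    exact sub_eq_zero.1 (pow_eq_zero_iff (by norm_num) |>.1 this)
  exact hwim (hwz ▸ hreal z hfin)
end

section
/- Let ζ = exp(2πi/3), so conj(ζ) = ζ². For every k ∈ {0,1,2} there is no complex number T satisfying both T³ − 2ζT² + 2T − ζ = 0 and (ζ^k T)³ − 2ζ²(ζ^k T)² + 2(ζ^k T) − ζ² = 0. Consequently, the root sets of P(T) = T³ − 2ζT² + 2T − ζ and of its complex-conjugate polynomial T³ − 2ζ²T² + 2T − ζ² are disjoint even after multiplying the roots by any power of ζ. -/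
theorem zeta_prim : IsPrimitiveRoot ζ 3 := by
  have h := Complex.isPrimitiveRoot_exp 3 (by norm_num)
  have e : ζ = Complex.exp (2 * Real.pi * Complex.I / (3 : ℕ)) := by
    simp [ζ]
  rw [e]; exact h

/-- No complex number `T` is simultaneously a root of `P(T) = T³ − 2ζT² + 2T − ζ` and such
that `ζ^k·T` is a root of the complex-conjugate polynomial `T³ − 2ζ²T² + 2T − ζ²`, for any
power `ζ^k` of `ζ`: the root sets of `P` and of its conjugate are disjoint even after
multiplying the roots by any power of `ζ`. -/
theorem conjugate_spectra_disjoint (k : ℕ) (T : ℂ)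
    (hP : T ^ 3 - 2 * ζ * T ^ 2 + 2 * T - ζ = 0) :
    ¬ ((ζ ^ k * T) ^ 3 - 2 * ζ ^ 2 * (ζ ^ k * T) ^ 2 + 2 * (ζ ^ k * T) - ζ ^ 2 = 0) := by
  intro hQ
  have h3 : ζ ^ 3 = 1 := zeta_prim.pow_eq_one
  have h1 : ζ - 1 ≠ 0 := sub_ne_zero.mpr (zeta_prim.ne_one (by norm_num))
  have h0 : ζ ≠ 0 := zeta_prim.ne_zero (by norm_num)
  have hs : ζ ^ 2 + ζ + 1 = 0 := by
    apply mul_left_cancel₀ h1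
    linear_combination h3
  have hk : ζ ^ k = ζ ^ (k % 3) := by
    conv_lhs => rw [← Nat.div_add_mod k 3, pow_add, pow_mul, h3, one_pow, one_mul]
  rw [hk] at hQ
  have hlt : k % 3 < 3 := Nat.mod_lt _ (by norm_num)
  generalize k % 3 = j at hQ hlt
  generalize ζ = w at *
  interval_cases j
  · have hT : 2 * T ^ 2 + 1 = 0 := by
      apply mul_left_cancel₀ (mul_ne_zero h0 h1)
      linear_combination hP - hQ
    have hT0 : T = 0 := by
      linear_combination (2 / 3) * hP - (1 / 3) * (T - 2 * w) * hT
    rw [hT0] at hT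
    norm_num at hT
  · have hT : 2 * T - w = 0 := by
      apply mul_left_cancel₀ h1
      linear_combination hQ - hP - (T ^ 3 - 2 * w * T ^ 2) * h3
    have hT0 : T = w / 2 := by linear_combination hT / 2
    rw [hT0] at hP
    have : (3 / 8 : ℂ) = 0 := by linear_combination -hP - (3 / 8) * h3
    norm_num at this
  · have hT : 2 * T ^ 2 + 2 * (w + 1) * T - w = 0 := by
      apply mul_left_cancel₀ h1
      linear_combination hQ - hP - (T ^ 3 * (w ^ 3 + 1) - 2 * w ^ 3 * T ^ 2 - 2 * T ^ 2) * h3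
    have hT2 : T ^ 2 = w ^ 2 * T + w / 2 := by linear_combination hT / 2 - T * hs
    have hT3 : T ^ 3 = 3 / 2 * w * T + 1 / 2 := by
      linear_combination (T + w ^ 2) * hT2 + (w * T + 1 / 2) * h3
    have hT0 : T = - w ^ 2 := by
      linear_combination (2 / 3) * w ^ 2 * (hP - hT3 + 2 * w * hT2 + hs) + (- T + 4 / 3 * w ^ 2 * T) * h3
    rw [hT0] at hT2
    apply h0
    linear_combination (2 / 3) * hT2 - (4 / 3) * w * h3
end

section
/- Let ζ = exp(2πi/3) and let X and Y be the 4×4 complex matrices X = [[ζ²−ζ, ζ²+ζ−1, ζ²−1, ζ], [3ζ²−3, −ζ²+3ζ−2, 3ζ−2, −ζ²+ζ+1], [6ζ²−5, 4ζ−4, ζ²+5ζ−6, −3ζ²+3ζ+1], [−ζ²+6ζ−5, −5ζ²+4ζ+1, −6ζ²+5ζ+1, −2ζ²−2ζ+3]] and Y = [[ζ²−ζ, ζ², ζ²−1, ζ], [ζ²−ζ+1, 2ζ²−ζ−1, ζ²−1, ζ], [ζ²−2ζ+1, 2ζ²−ζ−1, 2ζ²−ζ, ζ²+ζ−1], [ζ²−1,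 ζ−1, ζ−1, −ζ²]]. Denote by Λ²X and Λ²Y the induced endomorphisms of the second exterior power Λ²(ℂ⁴). Then det((Λ²X)∘(Λ²Y) − (Λ²Y)∘(Λ²X)) = −5292. -/
open ExteriorAlgebra

/-- The monodromy matrix `X` along the loop `ρ₁`. -/
noncomputable def matX : Matrix (Fin 4) (Fin 4) ℂ :=
  !![ζ^2 - ζ,          ζ^2 + ζ - 1,      ζ^2 - 1,          ζ;
     3*ζ^2 - 3,        -ζ^2 + 3*ζ - 2,   3*ζ - 2,          -ζ^2 + ζ + 1;
     6*ζ^2 - 5,        4*ζ - 4,          ζ^2 + 5*ζ - 6,    -3*ζ^2 + 3*ζ + 1;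
     -ζ^2 + 6*ζ - 5,   -5*ζ^2 + 4*ζ + 1, -6*ζ^2 + 5*ζ + 1, -2*ζ^2 - 2*ζ + 3]

/-- The monodromy matrix `Y` along the loop `ρ₂`. -/
noncomputable def matY : Matrix (Fin 4) (Fin 4) ℂ :=
  !![ζ^2 - ζ,       ζ^2,           ζ^2 - 1,     ζ;
     ζ^2 - ζ + 1,   2*ζ^2 - ζ - 1, ζ^2 - 1,     ζ;
     ζ^2 - 2*ζ + 1, 2*ζ^2 - ζ - 1, 2*ζ^2 - ζ,   ζ^2 + ζ - 1;
     ζ^2 - 1,       ζ - 1,         ζ - 1,       -ζ^2]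

/-- The wedge `v ∧ w` of two vectors lies in the second exterior power `Λ²(ℂ⁴)`. -/
theorem wedge_mem (v w : Fin 4 → ℂ) :
    ι ℂ v * ι ℂ w ∈ ⋀[ℂ]^2 (Fin 4 → ℂ) := by
  show ι ℂ v * ι ℂ w ∈ LinearMap.range (ι ℂ : (Fin 4 → ℂ) →ₗ[ℂ] _) ^ 2
  rw [pow_two]
  exact Submodule.mul_mem_mul (LinearMap.mem_range_self _ v) (LinearMap.mem_range_self _ w)

noncomputable def wX : Matrix (Fin 6) (Fin 6) ℂ :=
  !![-3, -1 - 2*ζ, -1 + 1*ζ, -2 - 3*ζ, 1*ζ, 1 + 1*ζ;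
     -10, -1 + 1*ζ, 2 + 3*ζ, 2 - 8*ζ, -4 - 4*ζ, 2 + 1*ζ;
     4 + 11*ζ, 0, 2 + 1*ζ, -11 - 7*ζ, -1 + 3*ζ, 1 - 1*ζ;
     1 + 14*ζ, 14 + 12*ζ, 4 - 8*ζ, -5 - 16*ζ, -12 - 6*ζ, -4 - 4*ζ;
     15 + 6*ζ, 4 - 7*ζ, -8 - 7*ζ, -12, 1 + 8*ζ, -2 + 1*ζ;
     -9*ζ, -11 - 4*ζ, 3 + 8*ζ, 6 + 15*ζ, 10 + 2*ζ, 3]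

noncomputable def wY : Matrix (Fin 6) (Fin 6) ℂ :=
  !![-1 + 3*ζ, 2 + 1*ζ, -1*ζ, -2 - 4*ζ, -2, 0;
     3*ζ, -1 - 2*ζ, -1 + 1*ζ, -4 - 4*ζ, -1 + 2*ζ, 1 + 1*ζ;
     2 + 1*ζ, 0, 0, -1 + 1*ζ, 1 + 1*ζ, 0;
     3, -3 - 5*ζ, -3 + 1*ζ, -6, 3 + 6*ζ, 1 + 1*ζ;
     -1 - 2*ζ, -1 + 1*ζ, 1 + 1*ζ, 3 + 3*ζ, 1 - 1*ζ, 0;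
     0, 2 + 1*ζ, -1 - 2*ζ, 1 - 1*ζ, -2 - 1*ζ, -1]

noncomputable def cM : Matrix (Fin 6) (Fin 6) ℂ :=
  !![-16 - 14*ζ, -34 + 14*ζ, 36 + 36*ζ, 27 + 40*ζ, 27 - 12*ζ, 7 - 10*ζ;
     -19 - 52*ζ, -56 + 6*ζ, 35 + 49*ζ, 46 + 80*ζ, 55 - 4*ζ, 6 - 12*ζ;
     -48 - 30*ζ, 11 + 58*ζ, 44 + 8*ζ, 79 + 32*ζ, -9 - 60*ζ, -11 - 14*ζ;
     -88 - 79*ζ, -21 + 21*ζ, 21 + 33*ζ, 81 + 32*ζ, 12 - 36*ζ, 2 + 1*ζ;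
     -30 + 45*ζ, 28 + 29*ζ, 22 - 4*ζ, -4 - 56*ζ, -40 - 30*ζ, 2 - 1*ζ;
     60 + 45*ζ, 44 + 1*ζ, -25 - 51*ζ, -34 - 29*ζ, -33 + 7*ζ, -13 - 2*ζ]

noncomputable def pM : Matrix (Fin 6) (Fin 6) ℂ :=
  !![1, -24 - 17*ζ, -178 - 77*ζ, 514 - 3087*ζ, -8178 - 8950*ζ, 16 - 31*ζ;
     0, 1 + 8*ζ, -531 + 48*ζ, 36 - 3856*ζ, -1288 - 6220*ζ, -28 - 86*ζ;
     0, 0, 197 + 729*ζ, -7775 - 5179*ζ, -6559 - 56*ζ, 14 + 56*ζ;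
     0, 0, 0, 2094 - 890*ζ, 2593 - 10073*ζ, 90 + 54*ζ;
     0, 0, 0, 0, -8101 - 13043*ζ, 70 - 99*ζ;
     0, 0, 0, 0, 0, 32 - 115*ζ]

noncomputable def tM : Matrix (Fin 6) (Fin 6) ℂ :=
  !![-16 - 14*ζ, 0, 0, 0, 0, 0;
     -19 - 52*ζ, -532 + 197*ζ, 0, 0, 0, 0;
     -48 - 30*ζ, 189 + 708*ζ, 445 + 1492*ζ, 0, 0, 0;
     -88 - 79*ζ, 580 + 1734*ζ, -196 - 659*ζ, -3159 - 21144*ζ, 0, 0;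
     -30 + 45*ζ, 1281 + 216*ζ, -205 + 484*ζ, -13655 - 7543*ζ, 6174 + 1344*ζ, 0;
     60 + 45*ζ, -639 - 990*ζ, 1627 + 1275*ζ, 8435 + 16648*ζ, 1092 + 2226*ζ, -42 + 42*ζ]

theorem ζ_sq : ζ ^ 2 = -ζ - 1 := by
  have h : IsPrimitiveRoot ζ 3 := by
    have := Complex.isPrimitiveRoot_exp 3 (by norm_num)
    simpa [ζ] using this
  have h1 : ζ ^ 3 = 1 := h.pow_eq_one
  have h2 : ζ ≠ 1 := h.ne_one (by norm_num)
  have h3 : (ζ - 1) * (ζ ^ 2 + ζ + 1) = 0 := by linear_combination h1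
  rcases mul_eq_zero.mp h3 with h | h
  · exact absurd (sub_eq_zero.mp h) h2
  · linear_combination h

/-- first indices of the pairs -/
def pI : Fin 6 → Fin 4 := ![0, 0, 0, 1, 1, 2]
/-- second indices of the pairs -/
def qI : Fin 6 → Fin 4 := ![1, 2, 3, 2, 3, 3]

/-- wedge of two vectors as an element of the exterior square -/
noncomputable def wdg (v w : Fin 4 → ℂ) : ⋀[ℂ]^2 (Fin 4 → ℂ) := ⟨ι ℂ v * ι ℂ w, wedge_mem v w⟩

theorem wdg_eq (v w : Fin 4 → ℂ) : wdg v w = exteriorPower.ιMulti ℂ 2 ![v, w] := by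
  apply Subtype.ext
  simp [wdg, exteriorPower.ιMulti_apply_coe, ExteriorAlgebra.ιMulti_apply, List.ofFn_succ]

/-- Plücker coordinates -/
noncomputable def plk (i : Fin 6) : Module.Dual ℂ (⋀[ℂ]^2 (Fin 4 → ℂ)) :=
  exteriorPower.pairingDual ℂ (Fin 4 → ℂ) 2
    (exteriorPower.ιMulti ℂ 2 ![LinearMap.proj (pI i), LinearMap.proj (qI i)])

theorem plk_wdg (i : Fin 6) (v w : Fin 4 → ℂ) :
    plk i (wdg v w) = v (pI i) * w (qI i) - v (qI i) * w (pI i) := by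
  rw [wdg_eq, plk, exteriorPower.pairingDual_ιMulti_ιMulti, Matrix.det_fin_two]
  simp

/-- basis vectors -/
noncomputable def bv (j : Fin 6) : ⋀[ℂ]^2 (Fin 4 → ℂ) :=
  wdg (Pi.single (pI j) 1) (Pi.single (qI j) 1)

theorem plk_bv (i j : Fin 6) : plk i (bv j) = if i = j then 1 else 0 := by
  rw [bv, plk_wdg]
  fin_cases i <;> fin_cases j <;> simp [pI, qI, Pi.single_apply]

theorem bv_li : LinearIndependent ℂ bv :=
  LinearIndependent.of_pairwise_dual_eq_zero_one _ plk
    (fun i j h => by simp only [plk_bv, if_neg h]) (fun i => by simp [plk_bv])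

/-- the basis -/
noncomputable def bB : Module.Basis (Fin 6) ℂ (⋀[ℂ]^2 (Fin 4 → ℂ)) :=
  basisOfLinearIndependentOfCardEqFinrank bv_li (by
    rw [exteriorPower.finrank_eq]; simp; decide)

theorem bB_apply (j : Fin 6) : bB j = bv j := by simp [bB]

theorem bB_coord (i : Fin 6) : bB.coord i = plk i := by
  apply bB.ext
  intro j
  rw [bB_apply, plk_bv, ← bB_apply, Module.Basis.coord_apply, Module.Basis.repr_self,
    Finsupp.single_apply]
  simp [eq_comm]

theorem toMatrix_wedge (M : Matrix (Fin 4) (Fin 4) ℂ) (L : Module.End ℂ (⋀[ℂ]^2 (Fin 4 → ℂ)))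
    (h : ∀ v w : Fin 4 → ℂ,
      ((L ⟨ι ℂ v * ι ℂ w, wedge_mem v w⟩ : ⋀[ℂ]^2 (Fin 4 → ℂ)) :
          ExteriorAlgebra ℂ (Fin 4 → ℂ))
        = ι ℂ (M.mulVec v) * ι ℂ (M.mulVec w)) :
    LinearMap.toMatrix bB bB L = Matrix.of fun i j =>
      M (pI i) (pI j) * M (qI i) (qI j) - M (qI i) (pI j) * M (pI i) (qI j) := by
  have h' : ∀ v w, L (wdg v w) = wdg (M.mulVec v) (M.mulVec w) :=
    fun v w => Subtype.ext (h v w)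
  ext i j
  rw [LinearMap.toMatrix_apply, ← Module.Basis.coord_apply, bB_coord, bB_apply, bv, h', plk_wdg]
  simp

set_option maxHeartbeats 2000000 in
theorem wX_eq : (Matrix.of fun i j =>
      matX (pI i) (pI j) * matX (qI i) (qI j) - matX (qI i) (pI j) * matX (pI i) (qI j)) = wX := by
  have h := ζ_sq
  ext i j
  fin_cases i <;> fin_cases j <;> simp [pI, qI, matX, wX, h] <;> ring_nf <;> (try simp only [h]) <;> ring

set_option maxHeartbeats 2000000 in
theorem wY_eq : (Matrix.of fun i j =>
      matY (pI i) (pI j) * matY (qI i) (qI j) - matY (qI i) (pI j) * matY (pI i) (qI j)) = wY := by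
  have h := ζ_sq
  ext i j
  fin_cases i <;> fin_cases j <;> simp [pI, qI, matY, wY, h] <;> ring_nf <;> (try simp only [h]) <;> ring

set_option maxHeartbeats 2000000 in
theorem cM_eq : wX * wY - wY * wX = cM := by
  have h := ζ_sq
  ext i j
  fin_cases i <;> fin_cases j <;> simp [Matrix.mul_apply, Fin.sum_univ_succ, wX, wY, cM] <;> ring_nf <;> (try simp only [h]) <;> ring

set_option maxHeartbeats 2000000 in
theorem cp_eq : cM * pM = tM := by
  have h := ζ_sq
  ext i j
  fin_cases i <;> fin_cases j <;> simp [Matrix.mul_apply, Fin.sum_univ_succ, pM, tM, cM] <;> ring_nf <;> (try simp only [h]) <;> ring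

theorem det_pM : pM.det = ∏ i, pM i i := by
  apply Matrix.det_of_isUpperTriangular
  intro i j hij
  fin_cases i <;> fin_cases j <;> first | (exact absurd hij (by decide)) | simp [pM]

theorem det_tM : tM.det = ∏ i, tM i i := by
  apply Matrix.det_of_isLowerTriangular
  intro i j hij
  fin_cases i <;> fin_cases j <;> first | (exact absurd hij (by decide)) | simp [tM]

theorem prod_pM : ∏ i, pM i i = 20849186254332 + 18986560986198*ζ := by
  have h := ζ_sq
  have e1 : (1 + 8*ζ) * (197 + 729*ζ) = -5635 - 3527*ζ := by
    linear_combination (5832 : ℂ) * h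
  have e2 : (2094 - 890*ζ) * (-8101 - 13043*ζ) = -28571764 - 31710422*ζ := by
    linear_combination (11608270 : ℂ) * h
  have e3 : (-5635 - 3527*ζ) * (-28571764 - 31710422*ζ) = 49159231746 + 167618181204*ζ := by
    linear_combination (111842658394 : ℂ) * h
  have e4 : (49159231746 + 167618181204*ζ) * (32 - 115*ζ) = 20849186254332 + 18986560986198*ζ := by
    linear_combination (-19276090838460 : ℂ) * h
  have e : ∏ i, pM i i = ((1 + 8*ζ) * (197 + 729*ζ)) * ((2094 - 890*ζ) * (-8101 - 13043*ζ)) * (32 - 115*ζ) := by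
    simp [Fin.prod_univ_succ, pM]; ring
  rw [e, e1, e2, e3, e4]

theorem prod_tM : ∏ i, tM i i = -5292 * (20849186254332 + 18986560986198*ζ) := by
  have h := ζ_sq
  have e1 : (-16 - 14*ζ) * (-532 + 197*ζ) = 11270 + 7054*ζ := by
    linear_combination (-2758 : ℂ) * h
  have e2 : (445 + 1492*ζ) * (-3159 - 21144*ζ) = 30141093 + 17424540*ζ := by
    linear_combination (-31546848 : ℂ) * h
  have e3 : (6174 + 1344*ζ) * (-42 + 42*ζ) = -315756 + 146412*ζ := by
    linear_combination (56448 : ℂ) * h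
  have e4 : (11270 + 7054*ζ) * (30141093 + 17424540*ζ) = 216777412950 + 286077130662*ζ := by
    linear_combination (122912705160 : ℂ) * h
  have e5 : (216777412950 + 286077130662*ζ) * (-315756 + 146412*ζ) = -110333893657924944 - 100476880738959816*ζ := by
    linear_combination (41885124854484744 : ℂ) * h
  have e : ∏ i, tM i i = ((-16 - 14*ζ) * (-532 + 197*ζ)) * ((445 + 1492*ζ) * (-3159 - 21144*ζ)) * ((6174 + 1344*ζ) * (-42 + 42*ζ)) := by
    simp [Fin.prod_univ_succ, tM]; ring
  rw [e, e1, e2, e3, e4, e5]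
  ring

theorem prod_ne : (20849186254332 + 18986560986198*ζ : ℂ) ≠ 0 := by
  intro h0
  have h := ζ_sq
  have : (399323719219966818965551692 : ℂ) = 0 := by
    linear_combination (1862625268134 - 18986560986198*ζ) * h0 - (-360489498082615970346495204 : ℂ) * h
  norm_num at this

theorem det_cM : cM.det = -5292 := by
  have h := congrArg Matrix.det cp_eq
  rw [Matrix.det_mul, det_pM, det_tM, prod_pM, prod_tM] at h
  exact mul_right_cancel₀ prod_ne h

/-- If `Λ²X` and `Λ²Y` are the endomorphisms of the second exterior power `Λ²(ℂ⁴)` induced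
by `X` and `Y` (acting on wedges by `v ∧ w ↦ Xv ∧ Xw`, resp. `v ∧ w ↦ Yv ∧ Yw`), then
`det(Λ²X ∘ Λ²Y − Λ²Y ∘ Λ²X) = −5292`. -/
theorem det_commutator_exterior_square
    (ΛX ΛY : Module.End ℂ (⋀[ℂ]^2 (Fin 4 → ℂ)))
    (hX : ∀ v w : Fin 4 → ℂ,
      ((ΛX ⟨ι ℂ v * ι ℂ w, wedge_mem v w⟩ : ⋀[ℂ]^2 (Fin 4 → ℂ)) :
          ExteriorAlgebra ℂ (Fin 4 → ℂ))
        = ι ℂ (matX.mulVec v) * ι ℂ (matX.mulVec w))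
    (hY : ∀ v w : Fin 4 → ℂ,
      ((ΛY ⟨ι ℂ v * ι ℂ w, wedge_mem v w⟩ : ⋀[ℂ]^2 (Fin 4 → ℂ)) :
          ExteriorAlgebra ℂ (Fin 4 → ℂ))
        = ι ℂ (matY.mulVec v) * ι ℂ (matY.mulVec w)) :
    LinearMap.det (ΛX * ΛY - ΛY * ΛX : Module.End ℂ (⋀[ℂ]^2 (Fin 4 → ℂ))) = -5292 := by
  have e : LinearMap.toMatrix bB bB (ΛX * ΛY - ΛY * ΛX) = cM := by
    refine (map_sub (LinearMap.toMatrix bB bB) (ΛX * ΛY) (ΛY * ΛX)).trans ?_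
    rw [LinearMap.toMatrix_mul, LinearMap.toMatrix_mul,
      toMatrix_wedge matX ΛX hX, toMatrix_wedge matY ΛY hY, wX_eq, wY_eq, cM_eq]
  rw [← LinearMap.det_toMatrix bB, e, det_cM]
end

section
/- Let ζ = exp(2πi/3) and let A and B be the explicit 4×4 complex matrices A = [[0,0,1,ζ²],[ζ,0,0,ζ],[0,ζ,0,ζ],[0,0,0,−ζ²]] and B = [[0,ζ²−1,ζ,0],[0,ζ,0,0],[ζ,ζ−ζ²,1−ζ²,0],[1−ζ²,1−ζ²,1−ζ,1]]. Then A has order exactly 18 and B has order exactly 6 in GL(4,ℂ): A¹⁸ = I and B⁶ = I, while A^m ≠ I for 1 ≤ m < 18 and B^m ≠ I for 1 ≤ m < 6. -/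
theorem zeta_sq : ζ ^ 2 = -1 - ζ := by
  have h : IsPrimitiveRoot ζ 3 := by
    have := Complex.isPrimitiveRoot_exp 3 (by norm_num)
    simpa [ζ] using this
  have h3 := h.pow_eq_one
  have h1 : ζ - 1 ≠ 0 := sub_ne_zero.mpr (h.ne_one (by norm_num))
  apply mul_left_cancel₀ h1
  linear_combination h3

theorem zeta_ne_one : ζ ≠ 1 := by
  intro h
  have h2 := zeta_sq
  rw [h] at h2
  norm_num at h2

theorem matA_sq : matA ^ 2 =
    !![0, ζ, 0, 0; 0, 0, ζ, 0; -1 - ζ, 0, 0, -2 - ζ; 0, 0, 0, ζ] := by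
  have h := zeta_sq
  ext i j
  fin_cases i <;> fin_cases j <;>
    simp [pow_two, matA, Matrix.mul_apply, Fin.sum_univ_four] <;> grind

theorem matA_cube : matA ^ 3 =
    !![-1 - ζ, 0, 0, -1 - ζ; 0, -1 - ζ, 0, -1 - ζ; 0, 0, -1 - ζ, -1 - ζ; 0, 0, 0, -1] := by
  have h := zeta_sq
  rw [pow_succ, matA_sq]
  ext i j
  fin_cases i <;> fin_cases j <;>
    simp [matA, Matrix.mul_apply, Fin.sum_univ_four] <;> grind

theorem matA_six : matA ^ 6 =
    !![ζ, 0, 0, 1 + 2 * ζ; 0, ζ, 0, 1 + 2 * ζ; 0, 0, ζ, 1 + 2 * ζ; 0, 0, 0, 1] := by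
  have h := zeta_sq
  rw [show 6 = 3 + 3 from rfl, pow_add, matA_cube]
  ext i j
  fin_cases i <;> fin_cases j <;>
    simp [Matrix.mul_apply, Fin.sum_univ_four] <;> grind

theorem matA_nine : matA ^ 9 =
    !![1, 0, 0, -2 * ζ; 0, 1, 0, -2 * ζ; 0, 0, 1, -2 * ζ; 0, 0, 0, -1] := by
  have h := zeta_sq
  rw [show 9 = 6 + 3 from rfl, pow_add, matA_six, matA_cube]
  ext i j
  fin_cases i <;> fin_cases j <;>
    simp [Matrix.mul_apply, Fin.sum_univ_four] <;> grind

theorem matA_eighteen : matA ^ 18 = 1 := by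
  rw [show 18 = 9 + 9 from rfl, pow_add, matA_nine]
  ext i j
  fin_cases i <;> fin_cases j <;>
    simp [Matrix.mul_apply, Fin.sum_univ_four]

theorem matB_sq : matB ^ 2 =
    !![-1 - ζ, -1 - 2 * ζ, -1 + ζ, 0; 0, -1 - ζ, 0, 0;
       -1 + ζ, -1 + ζ, 2 + 2 * ζ, 0; 3 + 3 * ζ, 1 + 2 * ζ, 3, 1] := by
  have h := zeta_sq
  ext i j
  fin_cases i <;> fin_cases j <;>
    simp [pow_two, matB, Matrix.mul_apply, Fin.sum_univ_four] <;> grind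

theorem matB_cube : matB ^ 3 =
    !![-1 - 2 * ζ, 0, -2, 0; 0, 1, 0, 0; -2, 0, 1 + 2 * ζ, 0;
       2 + 4 * ζ, 0, 4 + 2 * ζ, 1] := by
  have h := zeta_sq
  rw [pow_succ, matB_sq]
  ext i j
  fin_cases i <;> fin_cases j <;>
    simp [matB, Matrix.mul_apply, Fin.sum_univ_four] <;> grind

theorem matB_six : matB ^ 6 = 1 := by
  have h := zeta_sq
  rw [show 6 = 3 + 3 from rfl, pow_add, matB_cube]
  ext i j
  fin_cases i <;> fin_cases j <;>
    simp [Matrix.mul_apply, Fin.sum_univ_four] <;> grind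

theorem matA_six_ne : matA ^ 6 ≠ 1 := by
  intro h
  rw [matA_six] at h
  have := congrFun (congrFun h 0) 0
  exact zeta_ne_one (by simpa using this)

theorem matA_nine_ne : matA ^ 9 ≠ 1 := by
  intro h
  rw [matA_nine] at h
  have h33 := congrFun (congrFun h 3) 3
  have hneg : (-1 : ℂ) = 1 := by simpa using h33
  norm_num at hneg

theorem matB_sq_ne : matB ^ 2 ≠ 1 := by
  intro h
  rw [matB_sq] at h
  have := congrFun (congrFun h 3) 2
  simp at this

theorem matB_cube_ne : matB ^ 3 ≠ 1 := by
  intro h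
  rw [matB_cube] at h
  have := congrFun (congrFun h 0) 2
  simp at this

/-- `A` has order exactly `18` and `B` has order exactly `6`. -/
theorem matA_order_18_matB_order_6 :
    matA ^ 18 = 1 ∧ (∀ m : ℕ, 1 ≤ m → m < 18 → matA ^ m ≠ 1) ∧
    matB ^ 6 = 1 ∧ (∀ m : ℕ, 1 ≤ m → m < 6 → matB ^ m ≠ 1) := by
  refine ⟨matA_eighteen, ?_, matB_six, ?_⟩
  · intro m h1 h2 hm
    have hg : matA ^ (Nat.gcd m 18) = 1 := pow_gcd_eq_one.mpr ⟨hm, matA_eighteen⟩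
    have hd : Nat.gcd m 18 ∣ 6 ∨ Nat.gcd m 18 ∣ 9 := by
      interval_cases m <;> decide
    rcases hd with ⟨k, hk⟩ | ⟨k, hk⟩
    · exact matA_six_ne (by rw [hk, pow_mul, hg, one_pow])
    · exact matA_nine_ne (by rw [hk, pow_mul, hg, one_pow])
  · intro m h1 h2 hm
    have hg : matB ^ (Nat.gcd m 6) = 1 := pow_gcd_eq_one.mpr ⟨hm, matB_six⟩
    have hd : Nat.gcd m 6 ∣ 2 ∨ Nat.gcd m 6 ∣ 3 := by
      interval_cases m <;> decide
    rcases hd with ⟨k, hk⟩ | ⟨k, hk⟩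
    · exact matB_sq_ne (by rw [hk, pow_mul, hg, one_pow])
    · exact matB_cube_ne (by rw [hk, pow_mul, hg, one_pow])
end
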